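/- Let σ > 0, let T = N·L, suppose ‖φ(x)‖² ≤ 1 for all x ∈ X, let f(x) = ⟨w, φ(x)⟩ for some w ∈ H, and let x* ∈ X satisfy f(x*) ≥ f(x) for all x ∈ X. Suppose batches X₁, …, X_N (each an L-tuple of points of X) are chosen so that for every n the Gram matrix of all previously selected points is invertible and X_n maximizes over all L-tuples X = (x¹,…,x^L) the batch acquisition (1/L)·Σ_{i=1}^L m_{(n−1)L}(xⁱ) + ‖w‖·(2·√(tr(cov_{n−1}(X,X))/L) − √(𝟙ᵀ cov_{n−1}(X,X) 𝟙 / L²)). Let β ∈ ℝ with β > 0 satisfy ‖ĉov_{n−1}(X_n,X_n)‖₂ ≤ β (spectral norm) for all n ∈ {1,…,N}, set C₂ = 8β / log(1 + β·σ⁻²), and let γ ∈ ℝ satisfy (1/2)·log det(I_T + σ⁻² K_T) ≤ γ, where K_T is the Gram matrix of all T selected points x₁,…,x_T. Then Σ_{t=1}^T (f(x*) − f(x_t)) ≤ ‖w‖·√(T·C₂·γ) and f(x*) − max_{1≤t≤T} f(x_t) ≤ ‖w‖·√(C₂·γ/T). -/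

import Mathlib

open scoped RealInnerProductSpace
open Matrix

noncomputable section

variable {X : Type*} {H : Type*} [NormedAddCommGroup H] [InnerProductSpace ℝ H]

/-- The kernel associated with the feature map `φ`: `k(x,y) = ⟪φ(x), φ(y)⟫`. -/
def ker (φ : X → H) (x y : X) : ℝ := ⟪φ x, φ y⟫

/-- Gram matrix of the points `xs`. -/
def gram (φ : X → H) {t : ℕ} (xs : Fin t → X) : Matrix (Fin t) (Fin t) ℝ :=
  Matrix.of fun i j => ker φ (xs i) (xs j)

/-- The vector `k_t(a) = (k(a,x₁),…,k(a,x_t))ᵀ`. -/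
def kvec (φ : X → H) {t : ℕ} (xs : Fin t → X) (a : X) : Fin t → ℝ :=
  fun i => ker φ a (xs i)

/-- The mean prediction `m_t(a) = k_t(a)ᵀ K_t⁻¹ (f(x₁),…,f(x_t))ᵀ`. -/
def meanFn (φ : X → H) (f : X → ℝ) {t : ℕ} (xs : Fin t → X) (a : X) : ℝ :=
  kvec φ xs a ⬝ᵥ ((gram φ xs)⁻¹ *ᵥ (fun i => f (xs i)))

/-- The variance `σ_t²(a) = k(a,a) − k_t(a)ᵀ K_t⁻¹ k_t(a)`. -/
def varFn (φ : X → H) {t : ℕ} (xs : Fin t → X) (a : X) : ℝ :=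
  ker φ a a - kvec φ xs a ⬝ᵥ ((gram φ xs)⁻¹ *ᵥ kvec φ xs a)

/-- `σ_t(a) = √(σ_t²(a))`. -/
def sigmaFn (φ : X → H) {t : ℕ} (xs : Fin t → X) (a : X) : ℝ := Real.sqrt (varFn φ xs a)

/-- The noise-free batch covariance matrix `cov(X,X)` after selecting the points `xs`. -/
def covMat (φ : X → H) {t L : ℕ} (xs : Fin t → X) (XX : Fin L → X) :
    Matrix (Fin L) (Fin L) ℝ :=
  Matrix.of fun i j =>
    ker φ (XX i) (XX j) - kvec φ xs (XX i) ⬝ᵥ ((gram φ xs)⁻¹ *ᵥ kvec φ xs (XX j))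

/-- The regularized batch covariance matrix `ĉov(X,X)` after selecting the points `xs`. -/
def rcovMat (σ : ℝ) (φ : X → H) {t L : ℕ} (xs : Fin t → X) (XX : Fin L → X) :
    Matrix (Fin L) (Fin L) ℝ :=
  Matrix.of fun i j =>
    ker φ (XX i) (XX j) -
      kvec φ xs (XX i) ⬝ᵥ ((gram φ xs + σ ^ 2 • 1)⁻¹ *ᵥ kvec φ xs (XX j))

/-- The batch acquisition function:
`(1/L)·Σᵢ m(xⁱ) + w·(2√(tr(cov(X,X))/L) − √(𝟙ᵀ cov(X,X) 𝟙 / L²))`. -/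
def batchAcq (φ : X → H) (f : X → ℝ) (wnorm : ℝ) {t L : ℕ} (xs : Fin t → X)
    (XX : Fin L → X) : ℝ :=
  (1 / (L : ℝ)) * ∑ i, meanFn φ f xs (XX i) +
    wnorm * (2 * Real.sqrt ((covMat φ xs XX).trace / (L : ℝ)) -
      Real.sqrt ((∑ i, ∑ j, covMat φ xs XX i j) / (L : ℝ) ^ 2))

/-- The first `m` batches of points, flattened into a single sequence of `m·L` points. -/
def flatPts {N L : ℕ} (hL : 0 < L) (xb : Fin N → Fin L → X) (m : ℕ) (hm : m ≤ N) :
    Fin (m * L) → X :=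
  fun j => xb ⟨j.val / L, lt_of_lt_of_le ((Nat.div_lt_iff_lt_mul hL).mpr j.isLt) hm⟩
    ⟨j.val % L, Nat.mod_lt _ hL⟩

section Residual

variable (φ : X → H) {t : ℕ} (xs : Fin t → X)

lemma gram_transpose : (_root_.gram φ xs)ᵀ = _root_.gram φ xs := by
  ext i j
  exact real_inner_comm _ _

/-- The component of `φ a` orthogonal to the span of the features of the points `xs`. -/
def featureResidual (a : X) : H :=
  φ a - ∑ j, ((_root_.gram φ xs)⁻¹ *ᵥ kvec φ xs a) j • φ (xs j)

lemma inner_feature_sum (a : X) (c : Fin t → ℝ) :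
    ⟪φ a, ∑ j, c j • φ (xs j)⟫ = kvec φ xs a ⬝ᵥ c := by
  simp [inner_sum, real_inner_smul_right, dotProduct, kvec, ker, mul_comm]

lemma inner_sum_sum (c : Fin t → ℝ) :
    ⟪∑ j, c j • φ (xs j), ∑ j, c j • φ (xs j)⟫ = c ⬝ᵥ (_root_.gram φ xs *ᵥ c) := by
  rw [sum_inner]
  simp only [real_inner_smul_left, inner_feature_sum]
  rfl

lemma inner_feature_residual (a b : X) :
    ⟪φ a, featureResidual φ xs b⟫ =
      ker φ a b - kvec φ xs a ⬝ᵥ ((_root_.gram φ xs)⁻¹ *ᵥ kvec φ xs b) := by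
  rw [featureResidual, inner_sub_right, inner_feature_sum, ker]

variable {φ xs}

lemma inner_point_residual (h : IsUnit (_root_.gram φ xs).det) (j : Fin t) (a : X) :
    ⟪φ (xs j), featureResidual φ xs a⟫ = 0 := by
  have hc : _root_.gram φ xs *ᵥ ((_root_.gram φ xs)⁻¹ *ᵥ kvec φ xs a) = kvec φ xs a := by
    rw [mulVec_mulVec, mul_nonsing_inv _ h, one_mulVec]
  have hj := congrFun hc j
  rw [inner_feature_residual, sub_eq_zero]
  refine Eq.trans (real_inner_comm _ _) hj.symm

lemma inner_sum_residual (h : IsUnit (_root_.gram φ xs).det) (c : Fin t → ℝ) (a : X) :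
    ⟪∑ j, c j • φ (xs j), featureResidual φ xs a⟫ = 0 := by
  simp [sum_inner, real_inner_smul_left, inner_point_residual h]

lemma covMat_apply {L : ℕ} (h : IsUnit (_root_.gram φ xs).det) (XX : Fin L → X) (i j : Fin L) :
    covMat φ xs XX i j = ⟪featureResidual φ xs (XX i), featureResidual φ xs (XX j)⟫ := by
  conv_rhs => rw [featureResidual, inner_sub_left, inner_sum_residual h, sub_zero,
    inner_feature_residual]
  rfl

lemma inner_residual_eq_sub_meanFn {w : H} {f : X → ℝ} (hf : ∀ a, f a = ⟪w, φ a⟫) (a : X) :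
    ⟪w, featureResidual φ xs a⟫ = f a - meanFn φ f xs a := by
  have hsymm : ((_root_.gram φ xs)⁻¹)ᵀ = (_root_.gram φ xs)⁻¹ := by
    rw [transpose_nonsing_inv, gram_transpose]
  have hmean : meanFn φ f xs a =
      ((_root_.gram φ xs)⁻¹ *ᵥ kvec φ xs a) ⬝ᵥ fun i => f (xs i) := by
    rw [meanFn, dotProduct_mulVec, ← mulVec_transpose, hsymm]
  rw [hmean, featureResidual, inner_sub_right, inner_sum, hf]
  simp [real_inner_smul_right, dotProduct, hf]

lemma trace_covMat {L : ℕ} (h : IsUnit (_root_.gram φ xs).det) (XX : Fin L → X) :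
    (covMat φ xs XX).trace = ∑ i, ‖featureResidual φ xs (XX i)‖ ^ 2 := by
  exact Finset.sum_congr rfl fun i _ =>
    (covMat_apply h XX i i).trans (real_inner_self_eq_norm_sq _)

lemma sum_covMat {L : ℕ} (h : IsUnit (_root_.gram φ xs).det) (XX : Fin L → X) :
    ∑ i, ∑ j, covMat φ xs XX i j = ‖∑ i, featureResidual φ xs (XX i)‖ ^ 2 := by
  rw [← real_inner_self_eq_norm_sq, sum_inner]
  simp only [covMat_apply h, inner_sum]

/-- The regret of a batch maximizing the acquisition function. -/
lemma sum_regret_le_of_batchAcq_le {L : ℕ} (hL : 0 < L) (h : IsUnit (_root_.gram φ xs).det)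
    {w : H} {f : X → ℝ} (hf : ∀ a, f a = ⟪w, φ a⟫) (xstar : X) (XX : Fin L → X)
    (hacq : batchAcq φ f ‖w‖ xs (fun _ : Fin L => xstar) ≤ batchAcq φ f ‖w‖ xs XX) :
    ∑ i, (f xstar - f (XX i)) ≤ 2 * ‖w‖ * √(L * (covMat φ xs XX).trace) := by
  have hL' : (0 : ℝ) < L := by exact_mod_cast hL
  have hstar : batchAcq φ f ‖w‖ xs (fun _ : Fin L => xstar) =
      meanFn φ f xs xstar + ‖w‖ * ‖featureResidual φ xs xstar‖ := by
    have e : (L : ℝ) * ‖featureResidual φ xs xstar‖ ^ 2 / L = ‖featureResidual φ xs xstar‖ ^ 2 := by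
      field_simp
    rw [batchAcq, trace_covMat h, sum_covMat h]
    simp only [Finset.sum_const, Finset.card_univ, Fintype.card_fin,
      ← Nat.cast_smul_eq_nsmul ℝ, norm_smul, Real.norm_natCast, smul_eq_mul, ← div_pow]
    rw [e, Real.sqrt_sq (norm_nonneg _), Real.sqrt_sq (by positivity)]
    field_simp
    ring
  have h₁ : f xstar - meanFn φ f xs xstar ≤ ‖w‖ * ‖featureResidual φ xs xstar‖ :=
    inner_residual_eq_sub_meanFn hf (xs := xs) xstar ▸ real_inner_le_norm _ _
  have h₂ : ∑ i, meanFn φ f xs (XX i) - ∑ i, f (XX i) ≤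
      ‖w‖ * ‖∑ i, featureResidual φ xs (XX i)‖ := by
    have := real_inner_le_norm (-w) (∑ i, featureResidual φ xs (XX i))
    simpa [inner_sum, inner_residual_eq_sub_meanFn hf] using this
  have h₃ : √(L * (covMat φ xs XX).trace) = L * √((covMat φ xs XX).trace / L) := by
    rw [← Real.sqrt_sq hL'.le, ← Real.sqrt_mul (by positivity), Real.sqrt_sq hL'.le]
    congr 1
    field_simp
  rw [hstar, batchAcq, sum_covMat h, ← div_pow, Real.sqrt_sq (by positivity)] at hacq
  have h₄ := mul_le_mul_of_nonneg_left (h₁.trans (le_sub_iff_add_le'.mpr hacq)) hL'.le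
  have h₅ : (L : ℝ) * (1 / L * ∑ i, meanFn φ f xs (XX i) +
      ‖w‖ * (2 * √((covMat φ xs XX).trace / L) - ‖∑ i, featureResidual φ xs (XX i)‖ / L)) =
      ∑ i, meanFn φ f xs (XX i) + 2 * ‖w‖ * (L * √((covMat φ xs XX).trace / L)) -
        ‖w‖ * ‖∑ i, featureResidual φ xs (XX i)‖ := by
    field_simp
    ring
  rw [mul_sub, mul_sub, h₅] at h₄
  rw [h₃]
  simp only [Finset.sum_sub_distrib, Finset.sum_const, Finset.card_univ, Fintype.card_fin,
    nsmul_eq_mul]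
  linarith

end Residual

section Regularized

variable {φ : X → H} {t : ℕ} {xs : Fin t → X} {σ : ℝ}

lemma posDef_gram_add_smul_one (hσ : 0 < σ) : (_root_.gram φ xs + σ ^ 2 • 1).PosDef :=
  PosDef.posSemidef_add (posSemidef_gram ℝ (φ ∘ xs)) (PosDef.one.smul (by positivity))

lemma trace_covMat_le_trace_rcovMat {L : ℕ} (h : IsUnit (_root_.gram φ xs).det) (hσ : 0 < σ)
    (XX : Fin L → X) : (covMat φ xs XX).trace ≤ (rcovMat σ φ xs XX).trace := by
  refine Finset.sum_le_sum fun i _ => ?_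
  set a := XX i
  set c := (_root_.gram φ xs)⁻¹ *ᵥ kvec φ xs a with hc
  set d := (_root_.gram φ xs + σ ^ 2 • 1)⁻¹ *ᵥ kvec φ xs a with hd
  have hu : IsUnit (_root_.gram φ xs + σ ^ 2 • 1).det :=
    (isUnit_iff_isUnit_det _).mp (posDef_gram_add_smul_one hσ).isUnit
  have hKd : _root_.gram φ xs *ᵥ d = kvec φ xs a - σ ^ 2 • d := by
    have : (_root_.gram φ xs + σ ^ 2 • 1) *ᵥ d = kvec φ xs a := by
      rw [hd, mulVec_mulVec, mul_nonsing_inv _ hu, one_mulVec]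
    rw [add_mulVec, smul_mulVec, one_mulVec] at this
    exact eq_sub_of_add_eq this
  have hsplit : φ a - ∑ j, d j • φ (xs j) =
      featureResidual φ xs a + ∑ j, (c - d) j • φ (xs j) := by
    simp [featureResidual, sub_smul, hc]
  have hnorm : ⟪φ a - ∑ j, d j • φ (xs j), φ a - ∑ j, d j • φ (xs j)⟫ =
      ker φ a a - kvec φ xs a ⬝ᵥ d - σ ^ 2 * (d ⬝ᵥ d) := by
    rw [real_inner_sub_sub_self, inner_feature_sum, inner_sum_sum, hKd, dotProduct_sub,
      dotProduct_smul, dotProduct_comm d (kvec φ xs a), ker, smul_eq_mul]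
    ring
  have hpyth : ⟪φ a - ∑ j, d j • φ (xs j), φ a - ∑ j, d j • φ (xs j)⟫ =
      ⟪featureResidual φ xs a, featureResidual φ xs a⟫ +
        ⟪∑ j, (c - d) j • φ (xs j), ∑ j, (c - d) j • φ (xs j)⟫ := by
    rw [hsplit, real_inner_add_add_self, real_inner_comm (∑ j, (c - d) j • φ (xs j)),
      inner_sum_residual h]
    ring
  have hnn : 0 ≤ ⟪∑ j, (c - d) j • φ (xs j), ∑ j, (c - d) j • φ (xs j)⟫ := real_inner_self_nonneg
  have hdd : 0 ≤ σ ^ 2 * (d ⬝ᵥ d) := mul_nonneg (sq_nonneg _) (dotProduct_self_star_nonneg d)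
  have hr : rcovMat σ φ xs XX i i = ker φ a a - kvec φ xs a ⬝ᵥ d := rfl
  rw [diag_apply, diag_apply, covMat_apply h, hr]
  linarith

/-- The cross Gram matrix between the points `xs` and the batch `XX`. -/
def crossGram (φ : X → H) {t L : ℕ} (xs : Fin t → X) (XX : Fin L → X) :
    Matrix (Fin t) (Fin L) ℝ :=
  Matrix.of fun i j => ker φ (xs i) (XX j)

lemma rcovMat_eq_schur {L : ℕ} (XX : Fin L → X) :
    rcovMat σ φ xs XX = _root_.gram φ XX -
      (crossGram φ xs XX)ᴴ * (_root_.gram φ xs + σ ^ 2 • 1)⁻¹ * crossGram φ xs XX := by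
  ext i j
  have hcol (k : Fin L) : kvec φ xs (XX k) = fun l => crossGram φ xs XX l k := by
    ext l
    exact real_inner_comm _ _
  rw [Matrix.mul_assoc, Matrix.sub_apply, mul_apply', rcovMat, of_apply, hcol, hcol]
  rfl

lemma gram_sumElim {L : ℕ} (XX : Fin L → X) :
    Matrix.gram ℝ (φ ∘ Sum.elim xs XX) =
      fromBlocks (_root_.gram φ xs) (crossGram φ xs XX) (crossGram φ xs XX)ᴴ
        (_root_.gram φ XX) := by
  ext (i | i) (j | j)
  · rfl
  · rfl
  · exact real_inner_comm _ _
  · rfl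

lemma posSemidef_rcovMat {L : ℕ} (hσ : 0 < σ) (XX : Fin L → X) :
    (rcovMat σ φ xs XX).PosSemidef := by
  have hA := posDef_gram_add_smul_one (φ := φ) (xs := xs) hσ
  have := hA.isUnit.invertible
  rw [rcovMat_eq_schur, ← hA.fromBlocks₁₁]
  have hdiag : (fromBlocks (σ ^ 2 • 1 : Matrix (Fin t) (Fin t) ℝ) 0 0
      (0 : Matrix (Fin L) (Fin L) ℝ)).PosSemidef := by
    rw [smul_one_eq_diagonal, ← diagonal_zero (n := Fin L), fromBlocks_diagonal]
    exact PosSemidef.diagonal (by rintro (i | i) <;> simp [sq_nonneg])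
  have hsum := (posSemidef_gram ℝ (φ ∘ Sum.elim xs XX)).add hdiag
  rw [gram_sumElim, fromBlocks_add] at hsum
  simpa using hsum

lemma det_one_add_gram_sumElim {L : ℕ} (hσ : 0 < σ) (XX : Fin L → X) :
    (1 + (σ ^ 2)⁻¹ • Matrix.gram ℝ (φ ∘ Sum.elim xs XX)).det =
      (1 + (σ ^ 2)⁻¹ • _root_.gram φ xs).det * (1 + (σ ^ 2)⁻¹ • rcovMat σ φ xs XX).det := by
  have hs : σ ^ 2 ≠ 0 := by positivity
  have hA := posDef_gram_add_smul_one (φ := φ) (xs := xs) hσ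
  have hA' : 1 + (σ ^ 2)⁻¹ • _root_.gram φ xs =
      (σ ^ 2)⁻¹ • (_root_.gram φ xs + σ ^ 2 • 1) := by
    rw [smul_add, smul_smul, inv_mul_cancel₀ hs, one_smul, add_comm]
  have hinv : (1 + (σ ^ 2)⁻¹ • _root_.gram φ xs)⁻¹ =
      σ ^ 2 • (_root_.gram φ xs + σ ^ 2 • 1)⁻¹ := by
    refine inv_eq_right_inv ?_
    rw [hA', smul_mul_smul_comm, inv_mul_cancel₀ hs, one_smul,
      mul_nonsing_inv _ ((isUnit_iff_isUnit_det _).mp hA.isUnit)]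
  have : Invertible (1 + (σ ^ 2)⁻¹ • _root_.gram φ xs) :=
    (hA' ▸ (hA.smul (by positivity)).isUnit).invertible
  rw [gram_sumElim, ← fromBlocks_one, fromBlocks_smul, fromBlocks_add, det_fromBlocks₁₁,
    invOf_eq_nonsing_inv, hinv, rcovMat_eq_schur]
  congr 2
  simp only [zero_add, Matrix.smul_mul, Matrix.mul_smul, smul_smul, smul_sub]
  rw [add_sub_assoc]
  congr 3
  field_simp

lemma Matrix.IsHermitian.det_one_add_smul {n : Type*} [Fintype n] [DecidableEq n]
    {A : Matrix n n ℝ} (hA : A.IsHermitian) (c : ℝ) :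
    (1 + c • A).det = ∏ i, (1 + c * hA.eigenvalues i) := by
  conv_lhs => rw [hA.spectral_theorem, Unitary.conjStarAlgAut_apply, ← Matrix.smul_mul,
    det_one_add_mul_comm, Matrix.mul_smul, ← Matrix.mul_assoc, Unitary.coe_star_mul_self,
    Matrix.one_mul, ← diagonal_smul, ← diagonal_one, diagonal_add, det_diagonal]
  rfl

lemma le_div_log_mul_log {β c x : ℝ} (hβ : 0 < β) (hc : 0 < c) (hx : 0 ≤ x) (hxβ : x ≤ β) :
    x ≤ β / Real.log (1 + β * c) * Real.log (1 + c * x) := by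
  have hlog : 0 < Real.log (1 + β * c) := Real.log_pos (by nlinarith [mul_pos hβ hc])
  have hb := rpow_one_add_le_one_add_mul_self (s := β * c) (by nlinarith [mul_pos hβ hc])
    (p := x / β) (by positivity) ((div_le_one hβ).mpr hxβ)
  have hpos : 0 < 1 + β * c := by positivity
  have hlb := Real.log_le_log (Real.rpow_pos_of_pos hpos _) hb
  rw [Real.log_rpow hpos, show x / β * (β * c) = c * x by field_simp] at hlb
  calc x = β / Real.log (1 + β * c) * (x / β * Real.log (1 + β * c)) := by field_simp
    _ ≤ _ := by gcongr

lemma trace_rcovMat_le {L : ℕ} (hσ : 0 < σ) (XX : Fin L → X) {β : ℝ} (hβpos : 0 < β)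
    (hR : (rcovMat σ φ xs XX).IsHermitian) (hβ : ∀ i, |hR.eigenvalues i| ≤ β) :
    (rcovMat σ φ xs XX).trace ≤ β / Real.log (1 + β * (σ ^ 2)⁻¹) *
      Real.log (1 + (σ ^ 2)⁻¹ • rcovMat σ φ xs XX).det := by
  have hnn := hR.posSemidef_iff_eigenvalues_nonneg.mp (posSemidef_rcovMat hσ XX)
  rw [hR.trace_eq_sum_eigenvalues, hR.det_one_add_smul, Real.log_prod, Finset.mul_sum]
  · exact Finset.sum_le_sum fun i _ =>
      le_div_log_mul_log hβpos (by positivity) (hnn i) (le_of_abs_le (hβ i))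
  · intro i _
    have := mul_nonneg (by positivity : 0 ≤ (σ ^ 2)⁻¹) (hnn i)
    positivity

lemma det_one_add_gram_flatPts_succ {N L : ℕ} (hσ : 0 < σ) (hL : 0 < L)
    (xb : Fin N → Fin L → X) (m : ℕ) (hm : m < N) :
    (1 + (σ ^ 2)⁻¹ • _root_.gram φ (flatPts hL xb (m + 1) hm)).det =
      (1 + (σ ^ 2)⁻¹ • _root_.gram φ (flatPts hL xb m hm.le)).det *
        (1 + (σ ^ 2)⁻¹ • rcovMat σ φ (flatPts hL xb m hm.le) (xb ⟨m, hm⟩)).det := by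
  let e : Fin (m * L) ⊕ Fin L ≃ Fin ((m + 1) * L) :=
    finSumFinEquiv.trans (finCongr (Nat.succ_mul m L).symm)
  have he : flatPts hL xb (m + 1) hm ∘ e = Sum.elim (flatPts hL xb m hm.le) (xb ⟨m, hm⟩) := by
    ext (i | i)
    · rfl
    · simp [e, flatPts, Nat.mul_add_div hL, Nat.mul_comm m L, Nat.mod_eq_of_lt,
        Nat.div_eq_of_lt]
  rw [← det_one_add_gram_sumElim hσ, ← he, ← det_submatrix_equiv_self e]
  congr 1
  ext i j
  simp [one_apply, _root_.gram, ker]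

lemma sum_log_det_rcovMat {N L : ℕ} (hσ : 0 < σ) (hL : 0 < L) (xb : Fin N → Fin L → X)
    (m : ℕ) (hm : m ≤ N) :
    ∑ n : Fin m, Real.log (1 + (σ ^ 2)⁻¹ •
        rcovMat σ φ (flatPts hL xb n (n.isLt.le.trans hm)) (xb (Fin.castLE hm n))).det =
      Real.log (1 + (σ ^ 2)⁻¹ • _root_.gram φ (flatPts hL xb m hm)).det := by
  have hs : 0 < (σ ^ 2)⁻¹ := by positivity
  induction m with
  | zero =>
    have : IsEmpty (Fin (0 * L)) := by rw [Nat.zero_mul]; infer_instance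
    simp
  | succ m ih =>
    rw [Fin.sum_univ_castSucc, det_one_add_gram_flatPts_succ hσ hL xb m hm, Real.log_mul]
    · rw [← ih (Nat.le_of_succ_le hm)]
      rfl
    · exact (PosDef.one.add_posSemidef ((posSemidef_gram ℝ _).smul hs.le)).det_pos.ne'
    · exact (PosDef.one.add_posSemidef ((posSemidef_rcovMat hσ _).smul hs.le)).det_pos.ne'

end Regularized

/-- Theorem 2 (noise-free batch regret bounds). -/
theorem statement_1 [Nonempty X]
    (φ : X → H) (w : H) (f : X → ℝ) (hf : ∀ a, f a = ⟪w, φ a⟫)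
    (hk : ∀ a : X, ker φ a a ≤ 1)
    (σ : ℝ) (hσ : 0 < σ)
    (N L : ℕ) (hN : 0 < N) (hL : 0 < L)
    (xstar : X) (hstar : ∀ a : X, f a ≤ f xstar)
    (xb : Fin N → Fin L → X)
    (hinv : ∀ n : Fin N, IsUnit (gram φ (flatPts hL xb n.val n.isLt.le)).det)
    (hacq : ∀ n : Fin N, ∀ XX : Fin L → X,
      batchAcq φ f ‖w‖ (flatPts hL xb n.val n.isLt.le) XX ≤
        batchAcq φ f ‖w‖ (flatPts hL xb n.val n.isLt.le) (xb n))
    (β : ℝ) (hβpos : 0 < β)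
    (hherm : ∀ n : Fin N, (rcovMat σ φ (flatPts hL xb n.val n.isLt.le) (xb n)).IsHermitian)
    (hβ : ∀ n : Fin N, ∀ i : Fin L, |(hherm n).eigenvalues i| ≤ β)
    (γ : ℝ)
    (hγ : (1/2) * Real.log ((1 + (σ^2)⁻¹ • gram φ (flatPts hL xb N le_rfl)).det) ≤ γ) :
    (∑ n : Fin N, ∑ i : Fin L, (f xstar - f (xb n i))) ≤
        ‖w‖ * Real.sqrt (((N * L : ℕ) : ℝ) * (8 * β / Real.log (1 + β * (σ^2)⁻¹)) * γ) ∧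
    f xstar - (Finset.univ.sup'
        (Finset.univ_nonempty_iff.mpr ⟨(⟨0, hN⟩, ⟨0, hL⟩)⟩)
        fun p : Fin N × Fin L => f (xb p.1 p.2)) ≤
      ‖w‖ * Real.sqrt ((8 * β / Real.log (1 + β * (σ^2)⁻¹)) * γ / ((N * L : ℕ) : ℝ)) := by
  have hT : (0 : ℝ) < ((N * L : ℕ) : ℝ) := by exact_mod_cast Nat.mul_pos hN hL
  set C : ℝ := 8 * β / Real.log (1 + β * (σ ^ 2)⁻¹) with hC
  have hlog : 0 < Real.log (1 + β * (σ ^ 2)⁻¹) := Real.log_pos (by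
    have : 0 < β * (σ ^ 2)⁻¹ := by positivity
    linarith)
  have hCpos : 0 < C := by positivity
  let V (n : Fin N) : ℝ := (covMat φ (flatPts hL xb n.val n.isLt.le) (xb n)).trace
  have hV (n : Fin N) : 0 ≤ V n := by
    simp only [V, trace_covMat (hinv n)]
    positivity
  have hVsum : 4 * ∑ n, V n ≤ C * γ := by
    have hle : ∑ n, V n ≤ β / Real.log (1 + β * (σ ^ 2)⁻¹) *
        Real.log (1 + (σ ^ 2)⁻¹ • _root_.gram φ (flatPts hL xb N le_rfl)).det := by
      rw [← sum_log_det_rcovMat hσ, Finset.mul_sum]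
      exact Finset.sum_le_sum fun n _ => (trace_covMat_le_trace_rcovMat (hinv n) hσ _).trans
        (trace_rcovMat_le hσ _ hβpos (hherm n) (hβ n))
    have hmul := mul_le_mul_of_nonneg_left hγ hCpos.le
    calc 4 * ∑ n, V n ≤ _ := mul_le_mul_of_nonneg_left hle (by norm_num)
      _ = C * (1 / 2 * Real.log
          (1 + (σ ^ 2)⁻¹ • _root_.gram φ (flatPts hL xb N le_rfl)).det) := by
        rw [hC]
        ring
      _ ≤ C * γ := hmul
  have hregret : ∑ n : Fin N, ∑ i : Fin L, (f xstar - f (xb n i)) ≤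
      ‖w‖ * √(((N * L : ℕ) : ℝ) * C * γ) := by
    have hcs : ∑ n, √(L * V n) ≤ √((N * L : ℕ) * ∑ n, V n) := by
      refine Real.le_sqrt_of_sq_le ?_
      refine (sq_sum_le_card_mul_sum_sq).trans_eq ?_
      rw [Finset.sum_congr rfl fun n _ => Real.sq_sqrt (mul_nonneg L.cast_nonneg (hV n)),
        ← Finset.mul_sum]
      simp [mul_assoc]
    calc ∑ n : Fin N, ∑ i : Fin L, (f xstar - f (xb n i))
        ≤ ∑ n, 2 * ‖w‖ * √(L * V n) := Finset.sum_le_sum fun n _ =>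
          sum_regret_le_of_batchAcq_le hL (hinv n) hf xstar (xb n) (hacq n _)
      _ ≤ 2 * ‖w‖ * √((N * L : ℕ) * ∑ n, V n) := by
        rw [← Finset.mul_sum]
        gcongr
      _ = ‖w‖ * √(2 ^ 2 * ((N * L : ℕ) * ∑ n, V n)) := by
        rw [Real.sqrt_mul (sq_nonneg 2), Real.sqrt_sq zero_le_two]
        ring
      _ ≤ ‖w‖ * √(((N * L : ℕ) : ℝ) * C * γ) := by
        gcongr ‖w‖ * √?_
        have := mul_le_mul_of_nonneg_left hVsum hT.le
        linarith
  refine ⟨hregret, ?_⟩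
  set M := Finset.univ.sup' (Finset.univ_nonempty_iff.mpr ⟨(⟨0, hN⟩, ⟨0, hL⟩)⟩)
    fun p : Fin N × Fin L => f (xb p.1 p.2)
  have hM (n : Fin N) (i : Fin L) : f (xb n i) ≤ M :=
    Finset.le_sup' (fun p : Fin N × Fin L => f (xb p.1 p.2)) (Finset.mem_univ (n, i))
  have hmin : (N * L : ℕ) * (f xstar - M) ≤ ∑ n : Fin N, ∑ i : Fin L, (f xstar - f (xb n i)) := by
    calc (N * L : ℕ) * (f xstar - M) = ∑ _n : Fin N, ∑ _i : Fin L, (f xstar - M) := by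
          simp only [Finset.sum_const, Finset.card_univ, Fintype.card_fin, nsmul_eq_mul,
            Nat.cast_mul, mul_assoc]
      _ ≤ _ := Finset.sum_le_sum fun n _ => Finset.sum_le_sum fun i _ =>
          sub_le_sub_left (hM n i) _
  have hsqrt : √(((N * L : ℕ) : ℝ) * C * γ) = (N * L : ℕ) * √(C * γ / (N * L : ℕ)) := by
    rw [← Real.sqrt_sq hT.le, ← Real.sqrt_mul (sq_nonneg _), Real.sqrt_sq hT.le]
    congr 1
    field_simp
  have := hmin.trans hregret
  rw [hsqrt, mul_left_comm] at this
  exact le_of_mul_le_mul_left this hT
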